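/- arXiv:1605.08188 — 3 statements merged into one kernel-verified Lean document; each statement's English description precedes it below -/
import Mathlib

section
/- Suppose ε ∈ (0,1), n ∈ ℕ, f is a probability density on ℝ^d, x₁, …, x_n ∈ ℝ^d are points with empirical measure \hat f_n (assigning mass 1/n to each x_i), 𝒟 is a family of densities on ℝ^d, and 𝒜 is a family of measurable subsets of ℝ^d such that: (i) d_TV(f₁, f₂) ≤ ‖f₁ − f₂‖_𝒜 + ε/2 for all f₁, f₂ ∈ 𝒟, (ii) ‖f − \hat f_n‖_𝒜 ≤ ε/4, and (iii) h ∈ 𝒟 satisfies ‖h − \hat f_n‖_𝒜 ≤ ‖g − \hat f_n‖_𝒜 for all g ∈ 𝒟. Then d_TV(h, f) ≤ 3·OPT + ε, where OPT = inf_{g ∈ 𝒟} d_TV(f, g). (If the infimum defining OPT is not attained, the conclusion holds with OPT replaced by d_TV(f, f*) for any f* ∈ 𝒟, hence in the limit with OPT.) -/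
open MeasureTheory
open scoped Classical

/-- A probability density function on ℝ^d. -/
def IsDensity {d : ℕ} (f : EuclideanSpace ℝ (Fin d) → ℝ) : Prop :=
  Measurable f ∧ (∀ x, 0 ≤ f x) ∧ (∫ x, f x) = 1

/-- Total variation distance between two densities. -/
noncomputable def dTV {d : ℕ} (f g : EuclideanSpace ℝ (Fin d) → ℝ) : ℝ :=
  (1 / 2) * ∫ x, |f x - g x|

/-- The 𝒜-norm of (the difference of) integrable functions: `sup_{A ∈ 𝒜} |∫_A (f₁-f₂)|`. -/
noncomputable def ANormFun {d : ℕ} (𝒜 : Set (Set (EuclideanSpace ℝ (Fin d))))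
    (h : EuclideanSpace ℝ (Fin d) → ℝ) : ℝ :=
  ⨆ A : 𝒜, |∫ x in (A : Set (EuclideanSpace ℝ (Fin d))), h x|

/-- The 𝒜-norm of the signed measure `g - \hat f_n`, where `\hat f_n` is the empirical
measure of the points `x₁, …, x_n`: `sup_{A ∈ 𝒜} |∫_A g - (1/n)·#{i : x_i ∈ A}|`. -/
noncomputable def ANormEmpDiff {d n : ℕ} (𝒜 : Set (Set (EuclideanSpace ℝ (Fin d))))
    (g : EuclideanSpace ℝ (Fin d) → ℝ) (x : Fin n → EuclideanSpace ℝ (Fin d)) : ℝ :=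
  ⨆ A : 𝒜, |(∫ t in (A : Set (EuclideanSpace ℝ (Fin d))), g t) -
    ((Finset.univ.filter fun i => x i ∈ (A : Set (EuclideanSpace ℝ (Fin d)))).card : ℝ) / n|

theorem IsDensity.integrable {d : ℕ} {f : EuclideanSpace ℝ (Fin d) → ℝ} (hf : IsDensity f) :
    Integrable f := by
  by_contra hni
  have := hf.2.2
  rw [integral_undef hni] at this
  exact zero_ne_one this

theorem dTV_comm {d : ℕ} (f g : EuclideanSpace ℝ (Fin d) → ℝ) : dTV f g = dTV g f := by
  simp only [dTV, abs_sub_comm]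

theorem dTV_triangle {d : ℕ} {f g k : EuclideanSpace ℝ (Fin d) → ℝ}
    (hf : Integrable f) (hg : Integrable g) (hk : Integrable k) :
    dTV f k ≤ dTV f g + dTV g k := by
  have hfg := (hf.sub hg).abs
  have hgk := (hg.sub hk).abs
  have hle : ∫ x, |f x - k x| ≤ ∫ x, (|f x - g x| + |g x - k x|) :=
    integral_mono (hf.sub hk).abs (hfg.add hgk) fun x => abs_sub_le (f x) (g x) (k x)
  have hadd : ∫ x, (|f x - g x| + |g x - k x|) = (∫ x, |f x - g x|) + ∫ x, |g x - k x| :=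
    integral_add hfg hgk
  unfold dTV
  linarith

/-- The difference of the masses two densities give to a set is at most their total variation
distance. -/
theorem IsDensity.abs_setIntegral_sub_le_dTV {d : ℕ} {f g : EuclideanSpace ℝ (Fin d) → ℝ}
    (hf : IsDensity f) (hg : IsDensity g) {A : Set (EuclideanSpace ℝ (Fin d))}
    (hA : MeasurableSet A) : |(∫ t in A, f t) - ∫ t in A, g t| ≤ dTV f g := by
  have hint : Integrable fun t => f t - g t := hf.integrable.sub hg.integrable
  rw [← integral_sub hf.integrable.integrableOn hg.integrable.integrableOn]
  have hsum := integral_add_compl hA hint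
  rw [integral_sub hf.integrable hg.integrable, hf.2.2, hg.2.2, sub_self] at hsum
  have hsum_abs := integral_add_compl hA hint.abs
  have hA_le := abs_integral_le_integral_abs (f := fun t => f t - g t) (μ := volume.restrict A)
  have hAc_le := abs_integral_le_integral_abs (f := fun t => f t - g t) (μ := volume.restrict Aᶜ)
  rw [eq_neg_of_add_eq_zero_right hsum, abs_neg] at hAc_le
  unfold dTV
  linarith

theorem IsDensity.bddAbove_empDiff {d n : ℕ} (𝒜 : Set (Set (EuclideanSpace ℝ (Fin d))))
    {g : EuclideanSpace ℝ (Fin d) → ℝ} (hg : IsDensity g)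
    (x : Fin n → EuclideanSpace ℝ (Fin d)) :
    BddAbove (Set.range fun A : 𝒜 => |(∫ t in (A : Set (EuclideanSpace ℝ (Fin d))), g t) -
      ((Finset.univ.filter fun i => x i ∈ (A : Set (EuclideanSpace ℝ (Fin d)))).card : ℝ) / n|) := by
  refine ⟨1, ?_⟩
  rintro _ ⟨A, rfl⟩
  have hmass_nonneg : 0 ≤ ∫ t in (A : Set (EuclideanSpace ℝ (Fin d))), g t :=
    integral_nonneg hg.2.1
  have hmass_le : ∫ t in (A : Set (EuclideanSpace ℝ (Fin d))), g t ≤ 1 :=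
    hg.2.2 ▸ setIntegral_le_integral hg.integrable (Filter.Eventually.of_forall hg.2.1)
  have hcard : (Finset.univ.filter fun i => x i ∈ (A : Set (EuclideanSpace ℝ (Fin d)))).card ≤ n :=
    (Finset.card_le_univ _).trans_eq (Fintype.card_fin n)
  have hemp_nonneg : (0 : ℝ) ≤
      ((Finset.univ.filter fun i => x i ∈ (A : Set (EuclideanSpace ℝ (Fin d)))).card : ℝ) / n := by
    positivity
  have hemp_le :
      ((Finset.univ.filter fun i => x i ∈ (A : Set (EuclideanSpace ℝ (Fin d)))).card : ℝ) / n ≤ 1 :=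
    div_le_one_of_le₀ (by exact_mod_cast hcard) (by positivity)
  rw [abs_le]
  constructor <;> linarith

theorem ANormFun_sub_le {d n : ℕ} (𝒜 : Set (Set (EuclideanSpace ℝ (Fin d))))
    {f g : EuclideanSpace ℝ (Fin d) → ℝ} (hf : IsDensity f) (hg : IsDensity g)
    (x : Fin n → EuclideanSpace ℝ (Fin d)) :
    ANormFun 𝒜 (fun t => f t - g t) ≤ ANormEmpDiff 𝒜 f x + ANormEmpDiff 𝒜 g x := by
  refine Real.iSup_le (fun A => ?_) (add_nonneg (Real.iSup_nonneg fun _ => abs_nonneg _)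
    (Real.iSup_nonneg fun _ => abs_nonneg _))
  rw [integral_sub hf.integrable.integrableOn hg.integrable.integrableOn]
  refine (abs_sub_le _ _ _).trans (add_le_add (le_ciSup (hf.bddAbove_empDiff 𝒜 x) A) ?_)
  rw [abs_sub_comm]
  exact le_ciSup (hg.bddAbove_empDiff 𝒜 x) A

theorem ANormEmpDiff_le_dTV_add {d n : ℕ} {𝒜 : Set (Set (EuclideanSpace ℝ (Fin d)))}
    (h𝒜 : ∀ A ∈ 𝒜, MeasurableSet A) {f g : EuclideanSpace ℝ (Fin d) → ℝ}
    (hf : IsDensity f) (hg : IsDensity g) (x : Fin n → EuclideanSpace ℝ (Fin d)) :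
    ANormEmpDiff 𝒜 g x ≤ dTV g f + ANormEmpDiff 𝒜 f x := by
  refine Real.iSup_le (fun A => ?_) (add_nonneg
    (mul_nonneg (by norm_num) (integral_nonneg fun _ => abs_nonneg _))
    (Real.iSup_nonneg fun _ => abs_nonneg _))
  exact (abs_sub_le _ _ _).trans (add_le_add (hg.abs_setIntegral_sub_le_dTV hf (h𝒜 A A.2))
    (le_ciSup (hf.bddAbove_empDiff 𝒜 x) A))

/-- Deterministic core of the VC-based learner: if (i) the 𝒜-norm witnesses total
variation distances on 𝒟 up to `ε/2`, (ii) the empirical measure of the points is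
`ε/4`-close to `f` in 𝒜-norm, and (iii) `h ∈ 𝒟` minimizes the 𝒜-distance to the
empirical measure over 𝒟, then `d_TV(h, f) ≤ 3·OPT + ε`. -/
theorem vc_minimizer_guarantee {d n : ℕ} (hn : 0 < n) (ε : ℝ) (hε0 : 0 < ε) (hε1 : ε < 1)
    (f : EuclideanSpace ℝ (Fin d) → ℝ) (hf : IsDensity f)
    (x : Fin n → EuclideanSpace ℝ (Fin d))
    (𝒟 : Set (EuclideanSpace ℝ (Fin d) → ℝ))
    (𝒜 : Set (Set (EuclideanSpace ℝ (Fin d))))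
    (h𝒜 : ∀ A ∈ 𝒜, MeasurableSet A)
    (h𝒟 : ∀ g ∈ 𝒟, IsDensity g)
    (hwitness : ∀ f₁ ∈ 𝒟, ∀ f₂ ∈ 𝒟, dTV f₁ f₂ ≤ ANormFun 𝒜 (fun t => f₁ t - f₂ t) + ε / 2)
    (hemp : ANormEmpDiff 𝒜 f x ≤ ε / 4)
    (h : EuclideanSpace ℝ (Fin d) → ℝ) (hh : h ∈ 𝒟)
    (hmin : ∀ g ∈ 𝒟, ANormEmpDiff 𝒜 h x ≤ ANormEmpDiff 𝒜 g x) :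
    dTV h f ≤ 3 * sInf (dTV f '' 𝒟) + ε := by
  have hbound : ∀ g ∈ 𝒟, dTV h f ≤ 3 * dTV f g + ε := by
    intro g hg
    have hd := h𝒟 h hh
    have gd := h𝒟 g hg
    have htri := dTV_triangle hd.integrable gd.integrable hf.integrable
    have hnorm := ANormFun_sub_le 𝒜 hd gd x
    have hgemp := ANormEmpDiff_le_dTV_add h𝒜 hf gd x
    rw [dTV_comm g f] at htri hgemp
    linarith [hwitness h hh g hg, hmin g hg]
  have hinf : (dTV h f - ε) / 3 ≤ sInf (dTV f '' 𝒟) := by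
    refine le_csInf (Set.Nonempty.image _ ⟨h, hh⟩) ?_
    rintro _ ⟨g, hg, rfl⟩
    linarith [hbound g hg]
  linarith
end

section
/- Let f be a log-concave probability density on ℝ^d that attains its maximum value M = max_{x ∈ ℝ^d} f(x) at some point. Then for every z ≥ 1, the Lebesgue volume of the superlevel set satisfies vol({x ∈ ℝ^d : f(x) ≥ M·e^{−z}}) ≤ e·z^d / M. -/
open MeasureTheory

/-- A log-concave density: a density of the form `f = exp φ` for an upper
semicontinuous concave function `φ : ℝ^d → [-∞, ∞)`. -/
def IsLogConcaveDensity {d : ℕ} (f : EuclideanSpace ℝ (Fin d) → ℝ) : Prop :=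
  IsDensity f ∧
  ∃ φ : EuclideanSpace ℝ (Fin d) → EReal,
    UpperSemicontinuous φ ∧ (∀ x, φ x ≠ ⊤) ∧
    (∀ x y : EuclideanSpace ℝ (Fin d), ∀ t : ℝ, 0 ≤ t → t ≤ 1 →
      (t : EReal) * φ x + ((1 - t : ℝ) : EReal) * φ y ≤ φ (t • x + (1 - t) • y)) ∧
    (∀ x, f x = if φ x = ⊥ then 0 else Real.exp (φ x).toReal)

/-- A log-concave density with maximum `f x₀`: contracting the superlevel set `{f ≥ f x₀ · e^{-z}}`
towards `x₀` by the factor `1 / z` lands in `{f ≥ f x₀ · e^{-1}}`. -/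
lemma IsLogConcaveDensity.le_apply_contract {d : ℕ} {f : EuclideanSpace ℝ (Fin d) → ℝ}
    (hf : IsLogConcaveDensity f) {x₀ x : EuclideanSpace ℝ (Fin d)} (hpos : 0 < f x₀)
    {z : ℝ} (hz : 1 ≤ z) (hx : f x₀ * Real.exp (-z) ≤ f x) :
    f x₀ * Real.exp (-1) ≤ f (z⁻¹ • x + (1 - z⁻¹) • x₀) := by
  obtain ⟨-, φ, -, htop, hconc, hφ⟩ := hf
  have ne_bot : ∀ y, 0 < f y → φ y ≠ ⊥ := fun y hy h => by simp [hφ, h] at hy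
  have hz0 : 0 < z := by linarith
  have hbx₀ := ne_bot x₀ hpos
  have hbx := ne_bot x (lt_of_lt_of_le (by positivity) hx)
  have h := hconc x x₀ z⁻¹ (by positivity) (inv_le_one_of_one_le₀ hz)
  rw [hφ x₀, hφ x, if_neg hbx₀, if_neg hbx, ← Real.exp_add, Real.exp_le_exp] at hx
  rw [hφ x₀, if_neg hbx₀, ← Real.exp_add]
  rw [← EReal.coe_toReal (htop x) hbx, ← EReal.coe_toReal (htop x₀) hbx₀] at h
  generalize z⁻¹ • x + (1 - z⁻¹) • x₀ = y at h ⊢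
  norm_cast at h
  have hby : φ y ≠ ⊥ := fun hb => by
    rw [hb, le_bot_iff] at h
    exact EReal.coe_ne_bot _ h
  rw [← EReal.coe_toReal (htop y) hby, EReal.coe_le_coe_iff] at h
  rw [hφ y, if_neg hby, Real.exp_le_exp]
  have hscale := mul_le_mul_of_nonneg_left hx (inv_nonneg.2 hz0.le)
  have hcancel : z⁻¹ * z = 1 := inv_mul_cancel₀ hz0.ne'
  linarith

/-- For a log-concave density `f` on ℝ^d attaining its maximum `M = f x₀`, the
superlevel set `{f ≥ M·e^{-z}}` has Lebesgue volume at most `e·z^d / M`, for `z ≥ 1`. -/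
theorem superlevel_volume_bound {d : ℕ} (f : EuclideanSpace ℝ (Fin d) → ℝ)
    (hf : IsLogConcaveDensity f) (x₀ : EuclideanSpace ℝ (Fin d))
    (hmax : ∀ x, f x ≤ f x₀) (z : ℝ) (hz : 1 ≤ z) :
    volume {x | f x₀ * Real.exp (-z) ≤ f x} ≤
      ENNReal.ofReal (Real.exp 1 * z ^ d / f x₀) := by
  obtain ⟨-, hnonneg, hint⟩ := hf.1
  have hpos : 0 < f x₀ := by
    by_contra hle
    have hzero : f = 0 := funext fun x =>
      le_antisymm ((hmax x).trans (not_lt.1 hle)) (hnonneg x)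
    simp [hzero] at hint
  have hz0 : 0 < z := by linarith
  have hfi : Integrable f := .of_integral_ne_zero (by simp [hint])
  have hmarkov : volume {x | f x₀ * Real.exp (-1) ≤ f x} ≤
      ENNReal.ofReal (Real.exp 1 / f x₀) := by
    have h := mul_meas_ge_le_integral_of_nonneg (.of_forall hnonneg) hfi (f x₀ * Real.exp (-1))
    have hfin := (hfi.measure_ge_lt_top (ε := f x₀ * Real.exp (-1)) (by positivity)).ne
    rw [hint, measureReal_def, mul_comm, ← le_div_iff₀ (by positivity)] at h
    rw [← ENNReal.ofReal_toReal hfin]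
    refine ENNReal.ofReal_le_ofReal (h.trans_eq ?_)
    rw [Real.exp_neg]
    field_simp
  have hsub : {x | f x₀ * Real.exp (-z) ≤ f x} ⊆
      AffineMap.homothety x₀ z '' {x | f x₀ * Real.exp (-1) ≤ f x} := fun x hx => by
    refine ⟨_, hf.le_apply_contract hpos hz hx, ?_⟩
    simp only [AffineMap.homothety_apply, vsub_eq_sub, vadd_eq_add]
    match_scalars
    · field_simp
    · field_simp
      ring
  calc volume {x | f x₀ * Real.exp (-z) ≤ f x}
      ≤ ENNReal.ofReal (z ^ d) * volume {x | f x₀ * Real.exp (-1) ≤ f x} := by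
        refine (measure_mono hsub).trans_eq ?_
        rw [Measure.addHaar_image_homothety, finrank_euclideanSpace_fin, abs_of_pos (by positivity)]
    _ ≤ ENNReal.ofReal (z ^ d) * ENNReal.ofReal (Real.exp 1 / f x₀) := by gcongr
    _ = ENNReal.ofReal (Real.exp 1 * z ^ d / f x₀) := by
        rw [← ENNReal.ofReal_mul (by positivity)]
        ring_nf
end

section
/- Let ε ∈ (0,1), let f be a log-concave probability density on ℝ^d with maximum value M = max f, and let L ∈ ℕ with L ≥ 2. For i ∈ [L], set y_i = M·(1−ε)^i, and suppose P_i ⊆ ℝ^d are measurable sets satisfying P_i ⊆ {x : f(x) ≥ y_i} and vol(P_i) ≥ (1−ε)·vol({x : f(x) ≥ y_i}). Define g(x) = max{y_i : i ∈ [L], x ∈ P_i} for x ∈ ⋃_j P_j and g(x) = 0 otherwise. Then for every y with y_L ≤ y ≤ y₁, one has vol({x : g(x) ≥ y}) ≥ (1−ε)·vol({x : f(x) ≥ y/(1−ε)}). -/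
open MeasureTheory
open scoped Classical

/-- Volume lower bound for superlevel sets of the polyhedral approximation: if
`y_i = M·(1-ε)^i` (for `i = 1, …, L`), each `P_i` sits inside the superlevel set
`{f ≥ y_i}` and captures a `(1-ε)`-fraction of its volume, and `g` is the max-type
function built from the `(y_i, P_i)`, then for every `y ∈ [y_L, y₁]`,
`vol({g ≥ y}) ≥ (1-ε)·vol({f ≥ y/(1-ε)})`. -/
theorem approx_superlevel_volume_lb {d L : ℕ} (ε : ℝ) (hε0 : 0 < ε) (hε1 : ε < 1)
    (f : EuclideanSpace ℝ (Fin d) → ℝ) (hf : IsLogConcaveDensity f)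
    (x₀ : EuclideanSpace ℝ (Fin d)) (hmax : ∀ x, f x ≤ f x₀)
    (hL : 2 ≤ L) (y : Fin L → ℝ)
    (hy : ∀ i : Fin L, y i = f x₀ * (1 - ε) ^ ((i : ℕ) + 1))
    (P : Fin L → Set (EuclideanSpace ℝ (Fin d)))
    (hPmeas : ∀ i, MeasurableSet (P i))
    (hPsub : ∀ i, P i ⊆ {x | y i ≤ f x})
    (hPvol : ∀ i, ENNReal.ofReal (1 - ε) * volume {x | y i ≤ f x} ≤ volume (P i))
    (g : EuclideanSpace ℝ (Fin d) → ℝ)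
    (hg : ∀ x, g x = if x ∈ ⋃ j, P j then sSup (y '' {i | x ∈ P i}) else 0) :
    ∀ t : ℝ, f x₀ * (1 - ε) ^ L ≤ t → t ≤ f x₀ * (1 - ε) →
      ENNReal.ofReal (1 - ε) * volume {x | t / (1 - ε) ≤ f x} ≤
        volume {x | t ≤ g x} := by
  have hM : 0 ≤ f x₀ := hf.1.2.1 x₀
  have hq0 : 0 < 1 - ε := by linarith
  intro t htL ht1
  have hlast : f x₀ * (1 - ε) ^ ((L - 1) + 2) ≤ t := by
    refine le_trans (mul_le_mul_of_nonneg_left ?_ hM) htL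
    exact pow_le_pow_of_le_one hq0.le (by linarith) (by omega)
  have hex : ∃ k : ℕ, f x₀ * (1 - ε) ^ (k + 2) ≤ t := ⟨L - 1, hlast⟩
  -- the level index `k` satisfies `M (1 - ε) ^ (k + 2) ≤ t ≤ M (1 - ε) ^ (k + 1)`
  obtain ⟨k, hkL, hk, htk⟩ : ∃ k : ℕ, k < L ∧ f x₀ * (1 - ε) ^ (k + 2) ≤ t ∧
      t ≤ f x₀ * (1 - ε) ^ (k + 1) := by
    refine ⟨Nat.find hex, ?_, Nat.find_spec hex, ?_⟩
    · have := Nat.find_min' hex hlast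
      omega
    · rcases h : Nat.find hex with _ | m
      · simpa using ht1
      · exact (not_le.mp (Nat.find_min hex (m := m) (by omega))).le
  let i : Fin L := ⟨k, hkL⟩
  have hyi : y i = f x₀ * (1 - ε) ^ (k + 1) := hy i
  have hsub : {x | t / (1 - ε) ≤ f x} ⊆ {x | y i ≤ f x} := by
    intro x hx
    change t / (1 - ε) ≤ f x at hx
    change y i ≤ f x
    refine le_trans ?_ hx
    rw [hyi, le_div_iff₀ hq0, mul_assoc, ← pow_succ]
    exact hk
  have hPg : P i ⊆ {x | t ≤ g x} := by
    intro x hx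
    have hxU : x ∈ ⋃ j, P j := Set.mem_iUnion.mpr ⟨i, hx⟩
    change t ≤ g x
    rw [hg x, if_pos hxU]
    exact (htk.trans_eq hyi.symm).trans
      (le_csSup (Set.toFinite _).bddAbove (Set.mem_image_of_mem y hx))
  calc ENNReal.ofReal (1 - ε) * volume {x | t / (1 - ε) ≤ f x}
      ≤ ENNReal.ofReal (1 - ε) * volume {x | y i ≤ f x} := by gcongr
    _ ≤ volume (P i) := hPvol i
    _ ≤ volume {x | t ≤ g x} := measure_mono hPg
end
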